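/- Discrete maximum principle for subdifferential measures: in the envelope setting, assume additionally that every interior node lies in the interior of the convex hull of Ω̄_h (so discrete subdifferentials at interior nodes are compact). Let v, w : Ω̄_h → ℝ be nodal functions with w a convex nodal function (∂w(z) ≠ ∅ for every z ∈ Ω_h^I). If v(z) ≥ w(z) for all z ∈ Ω_h^B and |∂v(z)| ≤ |∂w(z)| for all z ∈ Ω_h^I, then w(z) ≤ v(z) for all z ∈ Ω̄_h. -/

import Mathlib

open scoped BigOperators Classical

noncomputable section

/-- `z` belongs to the lattice `hℤ^d`. -/
def IsLatticePt {d : ℕ} (h : ℝ) (z : EuclideanSpace ℝ (Fin d)) : Prop :=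
  ∀ i, ∃ m : ℤ, z i = h * m

/-- The discrete (nodal) subdifferential
`∂v(z) = {p : v(x) ≥ v(z) + p·(x - z) for all nodes x ∈ Ω̄_h}`. -/
def nodalSubdiff {d : ℕ} (Ωh : Finset (EuclideanSpace ℝ (Fin d)))
    (v : EuclideanSpace ℝ (Fin d) → ℝ) (z : EuclideanSpace ℝ (Fin d)) :
    Set (EuclideanSpace ℝ (Fin d)) :=
  {p | ∀ x ∈ Ωh, v z + ∑ i, p i * (x i - z i) ≤ v x}

open MeasureTheory Metric

lemma IsCompact.measure_lt_measure_thickening {E : Type*} [NormedAddCommGroup E] [NormedSpace ℝ E]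
    [Nontrivial E] [MeasurableSpace E] [BorelSpace E] (μ : Measure E) [μ.IsOpenPosMeasure]
    [IsFiniteMeasureOnCompacts μ] {K : Set E} (hK : IsCompact K) (hne : K.Nonempty)
    {δ : ℝ} (hδ : 0 < δ) : μ K < μ (thickening δ K) := by
  have hsub : K ⊆ thickening δ K := self_subset_thickening hδ K
  have hdiff : (thickening δ K \ K).Nonempty := by
    by_contra hempty
    rw [Set.not_nonempty_iff_eq_empty, Set.sdiff_eq_empty] at hempty
    have hopen : IsOpen K := (hempty.antisymm hsub) ▸ isOpen_thickening
    have huniv : K = Set.univ := IsClopen.eq_univ ⟨hK.isClosed, hopen⟩ hne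
    have : NoncompactSpace E := NormedSpace.noncompactSpace ℝ E
    exact noncompact_univ E (huniv ▸ hK)
  have hpos : 0 < μ (thickening δ K \ K) :=
    (isOpen_thickening.sdiff hK.isClosed).measure_pos μ hdiff
  calc μ K < μ K + μ (thickening δ K \ K) := ENNReal.lt_add_right hK.measure_lt_top.ne hpos.ne'
    _ = μ (thickening δ K) := by
      rw [measure_add_sdiff hK.measurableSet.nullMeasurableSet, Set.union_eq_self_of_subset_left hsub]

lemma measure_setOf_inner_eq_zero {E : Type*} [NormedAddCommGroup E] [InnerProductSpace ℝ E]
    [FiniteDimensional ℝ E] [MeasurableSpace E] [BorelSpace E] (μ : Measure E)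
    [μ.IsAddHaarMeasure] {u : E} (hu : u ≠ 0) (c : ℝ) : μ {p : E | inner ℝ p u = c} = 0 := by
  rcases Set.eq_empty_or_nonempty {p : E | inner ℝ p u = c} with hempty | ⟨p₀, hp₀⟩
  · rw [hempty, measure_empty]
  have hmem : ∀ p : E, p ∈ AffineSubspace.mk' p₀ (ℝ ∙ u)ᗮ ↔ inner ℝ p u = inner ℝ p₀ u := by
    intro p
    rw [AffineSubspace.mem_mk', vsub_eq_sub, Submodule.mem_orthogonal_singleton_iff_inner_left,
      inner_sub_left, sub_eq_zero]
  refine measure_mono_null (t := (AffineSubspace.mk' p₀ (ℝ ∙ u)ᗮ : Set E)) ?_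
    (Measure.addHaar_affineSubspace μ _ ?_)
  · intro p hp
    exact (hmem p).2 (hp.trans hp₀.symm)
  · intro htop
    have h₁ := (hmem (p₀ + u)).1 (htop ▸ AffineSubspace.mem_top ℝ E _)
    rw [inner_add_left, add_eq_left, inner_self_eq_zero] at h₁
    exact hu h₁

section NodalSubdiff

variable {d : ℕ} {Ωh : Finset (EuclideanSpace ℝ (Fin d))} {v w : EuclideanSpace ℝ (Fin d) → ℝ}
  {z : EuclideanSpace ℝ (Fin d)}

lemma mem_nodalSubdiff_iff {p : EuclideanSpace ℝ (Fin d)} :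
    p ∈ nodalSubdiff Ωh v z ↔ ∀ x ∈ Ωh, v z + inner ℝ p (x - z) ≤ v x := by
  simp [nodalSubdiff, PiLp.inner_apply, mul_comm]

lemma isClosed_nodalSubdiff : IsClosed (nodalSubdiff Ωh v z) := by
  have heq : nodalSubdiff Ωh v z = ⋂ x ∈ Ωh, {p | v z + inner ℝ p (x - z) ≤ v x} := by
    ext p
    simp [mem_nodalSubdiff_iff]
  rw [heq]
  exact isClosed_biInter fun x _ => isClosed_le (by fun_prop) continuous_const

lemma isCompact_nodalSubdiff
    (hz : z ∈ interior (convexHull ℝ (Ωh : Set (EuclideanSpace ℝ (Fin d))))) :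
    IsCompact (nodalSubdiff Ωh v z) := by
  refine isCompact_of_isClosed_isBounded isClosed_nodalSubdiff ?_
  obtain ⟨r, hr, hball⟩ := nhds_basis_closedBall.mem_iff.1 (mem_interior_iff_mem_nhds.1 hz)
  obtain ⟨M, hM⟩ := (Ωh.image fun x => v x - v z).bddAbove
  refine isBounded_iff_forall_norm_le.2 ⟨M / r, fun p hp => ?_⟩
  rw [mem_nodalSubdiff_iff] at hp
  have hhull : convexHull ℝ (Ωh : Set (EuclideanSpace ℝ (Fin d))) ⊆
      {x | innerSL ℝ p x ≤ M + inner ℝ p z} := by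
    refine convexHull_min (fun x hx => ?_)
      (convex_halfSpace_le (innerSL ℝ p).toLinearMap.isLinear _)
    have h₁ := hp x hx
    have h₂ : v x - v z ≤ M := hM (by simpa using ⟨x, hx, rfl⟩)
    rw [inner_sub_right] at h₁
    simp only [Set.mem_ofPred_eq, innerSL_apply_apply]
    linarith
  have hmem : z + (r / ‖p‖) • p ∈ closedBall z r := by
    rcases eq_or_ne p 0 with rfl | hp₀
    · simp [hr.le]
    · rw [mem_closedBall, dist_eq_norm, add_sub_cancel_left, norm_smul, norm_div, norm_norm,
        div_mul_cancel₀ _ (norm_ne_zero_iff.2 hp₀), Real.norm_of_nonneg hr.le]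
  have h₃ := hhull (hball hmem)
  simp only [Set.mem_ofPred_eq, innerSL_apply_apply, inner_add_right, inner_smul_right,
    real_inner_self_eq_norm_sq] at h₃
  rw [le_div_iff₀ hr]
  rcases eq_or_ne p 0 with rfl | hp₀
  · simp at h₃ ⊢
    exact h₃
  · have hpn : ‖p‖ ≠ 0 := norm_ne_zero_iff.2 hp₀
    have h₄ : r / ‖p‖ * ‖p‖ ^ 2 = ‖p‖ * r := by field_simp
    linarith

lemma aedisjoint_nodalSubdiff {y : EuclideanSpace ℝ (Fin d)} (hz : z ∈ Ωh) (hy : y ∈ Ωh)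
    (hzy : z ≠ y) : AEDisjoint volume (nodalSubdiff Ωh v z) (nodalSubdiff Ωh v y) := by
  refine measure_mono_null ?_ (measure_setOf_inner_eq_zero volume (sub_ne_zero.2 hzy) (v z - v y))
  rintro p ⟨hpz, hpy⟩
  have h₁ := mem_nodalSubdiff_iff.1 hpz y hy
  have h₂ := mem_nodalSubdiff_iff.1 hpy z hz
  rw [← neg_sub z y, inner_neg_right] at h₁
  exact le_antisymm (by linarith) (by linarith)

/-- The subdifferentials of `w` over `{v < w}` are covered by those of `v` over the same set. -/
lemma iUnion_nodalSubdiff_subset :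
    ⋃ z ∈ Ωh.filter (fun z => v z < w z), nodalSubdiff Ωh w z ⊆
      ⋃ z ∈ Ωh.filter (fun z => v z < w z), nodalSubdiff Ωh v z := by
  intro p hp
  simp only [Set.mem_iUnion, Finset.mem_filter, exists_prop] at hp ⊢
  obtain ⟨z, ⟨hz, hvw⟩, hpz⟩ := hp
  rw [mem_nodalSubdiff_iff] at hpz
  obtain ⟨y, hy, hmin⟩ := Ωh.exists_min_image (fun x => v x - inner ℝ p x) ⟨z, hz⟩
  refine ⟨y, ⟨hy, ?_⟩, mem_nodalSubdiff_iff.2 fun x hx => ?_⟩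
  · have h₁ := hmin z hz
    have h₂ := hpz y hy
    rw [inner_sub_right] at h₂
    linarith
  · have h₁ := hmin x hx
    rw [inner_sub_right]
    linarith

lemma IsLatticePt.le_norm_sub {h : ℝ} (hh : 0 < h) {x : EuclideanSpace ℝ (Fin d)}
    (hx : IsLatticePt h x) (hz : IsLatticePt h z) (hxz : x ≠ z) : h ≤ ‖x - z‖ := by
  obtain ⟨i, hi⟩ : ∃ i, x i ≠ z i := by
    by_contra! hall
    exact hxz (PiLp.ext hall)
  obtain ⟨m, hm⟩ := hx i
  obtain ⟨n, hn⟩ := hz i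
  have hmn : m - n ≠ 0 := fun h₀ => hi (by rw [hm, hn, sub_eq_zero.1 h₀])
  have hone : (1 : ℝ) ≤ |((m - n : ℤ) : ℝ)| := by exact_mod_cast Int.one_le_abs hmn
  calc h ≤ h * |((m - n : ℤ) : ℝ)| := le_mul_of_one_le_right hh.le hone
    _ = ‖(x - z) i‖ := by
      rw [PiLp.sub_apply, hm, hn, ← mul_sub, Real.norm_eq_abs, abs_mul, abs_of_pos hh]
      push_cast
      rfl
    _ ≤ ‖x - z‖ := PiLp.norm_apply_le _ i

/-- Adding a strictly convex quadratic enlarges nodal subdifferentials, up to a translation, by a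
ball of radius proportional to the mesh size. -/
lemma add_mem_nodalSubdiff_add_sq {h : ℝ} (hh : 0 < h) (hΩ : ∀ x ∈ Ωh, IsLatticePt h x)
    (hz : z ∈ Ωh) {ε : ℝ} (hε : 0 < ε) (c : ℝ) {p : EuclideanSpace ℝ (Fin d)}
    (hp : p ∈ thickening (ε * h) (nodalSubdiff Ωh w z)) :
    p + (2 * ε) • z ∈ nodalSubdiff Ωh (fun x => w x + ε * (‖x‖ ^ 2 - c)) z := by
  obtain ⟨q, hq, hpq⟩ := mem_thickening_iff.1 hp
  refine mem_nodalSubdiff_iff.2 fun x hx => ?_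
  have h₁ := mem_nodalSubdiff_iff.1 hq x hx
  have h₂ : inner ℝ (p - q) (x - z) ≤ ε * ‖x - z‖ ^ 2 := by
    rcases eq_or_ne x z with rfl | hxz
    · simp
    · have h₃ := (hΩ x hx).le_norm_sub hh (hΩ z hz) hxz
      rw [dist_eq_norm] at hpq
      calc inner ℝ (p - q) (x - z) ≤ ‖p - q‖ * ‖x - z‖ := real_inner_le_norm _ _
        _ ≤ (ε * ‖x - z‖) * ‖x - z‖ := by
          gcongr
          exact hpq.le.trans (by gcongr)
        _ = ε * ‖x - z‖ ^ 2 := by ring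
  have h₄ := norm_sub_sq_real x z
  have h₅ : inner ℝ z (x - z) = inner ℝ x z - ‖z‖ ^ 2 := by
    rw [inner_sub_right, real_inner_self_eq_norm_sq, real_inner_comm]
  rw [h₄, inner_sub_left] at h₂
  rw [inner_add_left, real_inner_smul_left, h₅]
  linarith

lemma volume_nodalSubdiff_lt_add_sq (hd : 0 < d) {h : ℝ} (hh : 0 < h)
    (hΩ : ∀ x ∈ Ωh, IsLatticePt h x) (hz : z ∈ Ωh)
    (hint : z ∈ interior (convexHull ℝ (Ωh : Set (EuclideanSpace ℝ (Fin d)))))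
    (hne : (nodalSubdiff Ωh w z).Nonempty) {ε : ℝ} (hε : 0 < ε) (c : ℝ) :
    volume (nodalSubdiff Ωh w z) <
      volume (nodalSubdiff Ωh (fun x => w x + ε * (‖x‖ ^ 2 - c)) z) := by
  have : Nonempty (Fin d) := ⟨⟨0, hd⟩⟩
  calc volume (nodalSubdiff Ωh w z)
      < volume (thickening (ε * h) (nodalSubdiff Ωh w z)) :=
        (isCompact_nodalSubdiff hint).measure_lt_measure_thickening volume hne (by positivity)
    _ ≤ volume ((· + (2 * ε) • z) ⁻¹'
          nodalSubdiff Ωh (fun x => w x + ε * (‖x‖ ^ 2 - c)) z) :=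
        measure_mono fun p hp => add_mem_nodalSubdiff_add_sq hh hΩ hz hε c hp
    _ = _ := measure_preimage_add_right _ _ _

end NodalSubdiff

/-- **Discrete maximum principle for subdifferential measures.**  Let the finite node set
`Ω̄_h = Ω_h^I ∪ Ω_h^B ⊆ hℤ^d ∩ B_R(0)` be such that every interior node lies in the
interior of `conv(Ω̄_h)`.  Let `v, w` be nodal functions with `w` a convex nodal function.
If `v ≥ w` on `Ω_h^B` and `|∂v(z)| ≤ |∂w(z)|` for all `z ∈ Ω_h^I`, then `w ≤ v` on
`Ω̄_h`. -/
theorem discrete_subdifferential_maximum_principle (d : ℕ) (hd : 0 < d)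
    (h R : ℝ) (hh : 0 < h) (hR : 0 < R)
    (ΩI ΩB : Finset (EuclideanSpace ℝ (Fin d)))
    (hdisj : Disjoint ΩI ΩB)
    (hnodes : ∀ z ∈ ΩI ∪ ΩB, IsLatticePt h z ∧ ‖z‖ < R)
    -- every interior node lies in the interior of the convex hull of the node set:
    (hint : ∀ z ∈ ΩI,
      z ∈ interior (convexHull ℝ (↑(ΩI ∪ ΩB) : Set (EuclideanSpace ℝ (Fin d)))))
    (v w : EuclideanSpace ℝ (Fin d) → ℝ)
    -- `w` is a convex nodal function:
    (hwconv : ∀ z ∈ ΩI, (nodalSubdiff (ΩI ∪ ΩB) w z).Nonempty)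
    (hbdry : ∀ z ∈ ΩB, w z ≤ v z)
    (hmeas : ∀ z ∈ ΩI,
      MeasureTheory.volume (nodalSubdiff (ΩI ∪ ΩB) v z)
        ≤ MeasureTheory.volume (nodalSubdiff (ΩI ∪ ΩB) w z)) :
    ∀ z ∈ ΩI ∪ ΩB, w z ≤ v z := by
  by_contra! hcon
  obtain ⟨z₀, hz₀, hlt⟩ := hcon
  set ε := (w z₀ - v z₀) / (2 * R ^ 2) with hεdef
  have hε : 0 < ε := div_pos (sub_pos.2 hlt) (by positivity)
  have hεR : ε * R ^ 2 < w z₀ - v z₀ := by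
    have h₁ : ε * R ^ 2 = (w z₀ - v z₀) / 2 := by
      rw [hεdef]
      field_simp
    linarith
  set u : EuclideanSpace ℝ (Fin d) → ℝ := fun x => w x + ε * (‖x‖ ^ 2 - R ^ 2) with hu
  set E := (ΩI ∪ ΩB).filter (fun z => v z < u z) with hE
  have hEne : E.Nonempty := by
    refine ⟨z₀, Finset.mem_filter.2 ⟨hz₀, ?_⟩⟩
    have h₁ : 0 ≤ ε * ‖z₀‖ ^ 2 := by positivity
    simp only [hu]
    linarith
  have hEI : ∀ z ∈ E, z ∈ ΩI := by
    intro z hz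
    obtain ⟨hzΩ, hvu⟩ := Finset.mem_filter.1 hz
    refine (Finset.mem_union.1 hzΩ).resolve_right fun hzB => ?_
    have h₁ : ‖z‖ ^ 2 ≤ R ^ 2 := by
      gcongr
      exact (hnodes z hzΩ).2.le
    have h₂ : ε * (‖z‖ ^ 2 - R ^ 2) ≤ 0 :=
      mul_nonpos_of_nonneg_of_nonpos hε.le (sub_nonpos.2 h₁)
    have h₃ := hbdry z hzB
    simp only [hu] at hvu
    linarith
  have hEΩ : ∀ z ∈ E, z ∈ ΩI ∪ ΩB := fun z hz => (Finset.mem_filter.1 hz).1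
  have hsum : ∑ z ∈ E, volume (nodalSubdiff (ΩI ∪ ΩB) w z) <
      ∑ z ∈ E, volume (nodalSubdiff (ΩI ∪ ΩB) u z) :=
    ENNReal.sum_lt_sum_of_nonempty hEne fun z hz =>
      volume_nodalSubdiff_lt_add_sq hd hh (fun x hx => (hnodes x hx).1) (hEΩ z hz)
        (hint z (hEI z hz)) (hwconv z (hEI z hz)) hε (R ^ 2)
  refine hsum.not_ge ?_
  calc ∑ z ∈ E, volume (nodalSubdiff (ΩI ∪ ΩB) u z)
      = volume (⋃ z ∈ E, nodalSubdiff (ΩI ∪ ΩB) u z) :=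
        (measure_biUnion_finset₀
          (fun z hz y hy hzy => aedisjoint_nodalSubdiff (hEΩ z hz) (hEΩ y hy) hzy)
          fun z _ => isClosed_nodalSubdiff.measurableSet.nullMeasurableSet).symm
    _ ≤ volume (⋃ z ∈ E, nodalSubdiff (ΩI ∪ ΩB) v z) := measure_mono iUnion_nodalSubdiff_subset
    _ ≤ ∑ z ∈ E, volume (nodalSubdiff (ΩI ∪ ΩB) v z) := measure_biUnion_finset_le _ _
    _ ≤ ∑ z ∈ E, volume (nodalSubdiff (ΩI ∪ ΩB) w z) :=
        Finset.sum_le_sum fun z hz => hmeas z (hEI z hz)
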